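/- (Abstraction into homogeneous groups, social problem.) Suppose the index set I is partitioned into groups I^1, …, I^{n} such that all agents in group ℓ share the same constraint set X̄^ℓ. Let x̄⋆ = (x̄^{1,⋆},…,x̄^{n,⋆}) be any minimizer of the reduced social cost F̄^m(x̄) = Σ_{t∈H} p^t (Σ_ℓ |I^ℓ| x̄^{ℓt} + x^{0t})² over X̄^1 × … × X̄^{n}. Define x⋆ ∈ X by x^{i,⋆} = x̄^{ℓ,⋆} for every i ∈ I^ℓ and every ℓ. Then x⋆ is a minimizer of F^m over X, and moreover F^m(x⋆) = F̄^m(x̄⋆); in particular the optimal values of the full and the reduced social problems are equal. -/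

import Mathlib

/-- Social cost `F^m(x) = Σ_t pᵗ (Σ_i xⁱᵗ + x⁰ᵗ)²`. -/
noncomputable def Fsoc (h m : ℕ) (p x0 : Fin h → ℝ) (x : Fin m → Fin h → ℝ) : ℝ :=
  ∑ t, p t * ((∑ i, x i t) + x0 t) ^ 2

/-- Reduced social cost `F̄^m(x̄) = Σ_t pᵗ (Σ_ℓ |I^ℓ| x̄^{ℓt} + x⁰ᵗ)²`, where `cnt ℓ`
is the number of agents in group `ℓ`. -/
noncomputable def Fbar (h n : ℕ) (p x0 : Fin h → ℝ) (cnt : Fin n → ℕ)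
    (xb : Fin n → Fin h → ℝ) : ℝ :=
  ∑ t, p t * ((∑ ℓ, (cnt ℓ : ℝ) * xb ℓ t) + x0 t) ^ 2

/-- Constraint set `Xⁱ = {y ∈ ℝ^h : Σ_t yᵗ = γ, yᵗ ∈ [loᵗ, hiᵗ] ∀t}`. -/
def Xset (h : ℕ) (γ : ℝ) (lo hi : Fin h → ℝ) : Set (Fin h → ℝ) :=
  {y | (∑ t, y t) = γ ∧ ∀ t, y t ∈ Set.Icc (lo t) (hi t)}

theorem convex_Xset (h : ℕ) (γ : ℝ) (lo hi : Fin h → ℝ) : Convex ℝ (Xset h γ lo hi) := by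
  rintro x ⟨hxs, hxb⟩ y ⟨hys, hyb⟩ a b ha hb hab
  refine ⟨?_, fun t => convex_Icc (lo t) (hi t) (hxb t) (hyb t) ha hb hab⟩
  simp only [Pi.add_apply, Pi.smul_apply, smul_eq_mul, Finset.sum_add_distrib,
    ← Finset.mul_sum, hxs, hys, ← add_mul, hab, one_mul]

/-- A nonempty convex set contains a point whose `s.card`-fold multiple is the sum over `s`
of given points of the set. -/
theorem Convex.exists_card_smul_eq_sum {E ι : Type*} [AddCommGroup E] [Module ℝ E] {C : Set E}
    (hC : Convex ℝ C) (hne : C.Nonempty) (s : Finset ι) (y : ι → E) (hy : ∀ i ∈ s, y i ∈ C) :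
    ∃ z ∈ C, (s.card : ℝ) • z = ∑ i ∈ s, y i := by
  rcases s.eq_empty_or_nonempty with rfl | hs
  · obtain ⟨z, hz⟩ := hne
    exact ⟨z, hz, by simp⟩
  · have hcard : (s.card : ℝ) ≠ 0 := by exact_mod_cast hs.card_pos.ne'
    refine ⟨∑ i ∈ s, (s.card : ℝ)⁻¹ • y i,
      hC.sum_mem (fun _ _ => by positivity) (by simp [hcard]) hy, ?_⟩
    rw [← Finset.smul_sum, smul_inv_smul₀ hcard]

theorem Fsoc_eq_Fbar (h m n : ℕ) (p x0 : Fin h → ℝ) (g : Fin m → Fin n)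
    (y : Fin m → Fin h → ℝ) (yb : Fin n → Fin h → ℝ)
    (hy : ∀ ℓ, (((Finset.univ : Finset (Fin m)).filter (fun i => g i = ℓ)).card : ℝ) • yb ℓ =
      ∑ i ∈ (Finset.univ : Finset (Fin m)).filter (fun i => g i = ℓ), y i) :
    Fsoc h m p x0 y =
      Fbar h n p x0
        (fun ℓ => ((Finset.univ : Finset (Fin m)).filter (fun i => g i = ℓ)).card) yb := by
  unfold Fsoc Fbar
  refine Finset.sum_congr rfl fun t _ => ?_
  have hsum : ∑ i, y i t =
      ∑ ℓ, (((Finset.univ : Finset (Fin m)).filter (fun i => g i = ℓ)).card : ℝ) * yb ℓ t := by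
    rw [← Finset.sum_fiberwise Finset.univ g]
    refine Finset.sum_congr rfl fun ℓ _ => ?_
    simpa using (congrFun (hy ℓ) t).symm
  rw [hsum]

/-- Abstraction into homogeneous groups, social problem: Suppose `I` is
partitioned into groups `I^ℓ = g⁻¹(ℓ)` of agents sharing the same constraint set `X̄^ℓ`.
If `x̄⋆` minimizes the reduced cost `F̄^m` over `X̄¹ × ⋯ × X̄ⁿ`, then `x⋆` defined by
`x^{i,⋆} = x̄^{g(i),⋆}` is feasible and minimizes `F^m` over `X`, and moreover
`F^m(x⋆) = F̄^m(x̄⋆)`: the optimal values of the full and reduced problems coincide. -/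
theorem stmt_15 (h m n : ℕ) (hh : 0 < h) (hm : 0 < m)
    (p x0 : Fin h → ℝ) (hp : ∀ t, 0 ≤ p t) (hx0 : ∀ t, 0 ≤ x0 t)
    (γb : Fin n → ℝ) (lob hib : Fin n → Fin h → ℝ)
    (hγb : ∀ ℓ, 0 < γb ℓ) (hlob : ∀ ℓ t, 0 ≤ lob ℓ t) (hlhb : ∀ ℓ t, lob ℓ t ≤ hib ℓ t)
    (hXne : ∀ ℓ, (Xset h (γb ℓ) (lob ℓ) (hib ℓ)).Nonempty)
    (g : Fin m → Fin n)
    (xb : Fin n → Fin h → ℝ)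
    (hxb : ∀ ℓ, xb ℓ ∈ Xset h (γb ℓ) (lob ℓ) (hib ℓ))
    (hxbmin : ∀ yb : Fin n → Fin h → ℝ, (∀ ℓ, yb ℓ ∈ Xset h (γb ℓ) (lob ℓ) (hib ℓ)) →
      Fbar h n p x0 (fun ℓ => ((Finset.univ : Finset (Fin m)).filter (fun i => g i = ℓ)).card) xb ≤
      Fbar h n p x0 (fun ℓ => ((Finset.univ : Finset (Fin m)).filter (fun i => g i = ℓ)).card) yb) :
    (∀ i, xb (g i) ∈ Xset h (γb (g i)) (lob (g i)) (hib (g i))) ∧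
    (∀ y : Fin m → Fin h → ℝ, (∀ i, y i ∈ Xset h (γb (g i)) (lob (g i)) (hib (g i))) →
      Fsoc h m p x0 (fun i => xb (g i)) ≤ Fsoc h m p x0 y) ∧
    Fsoc h m p x0 (fun i => xb (g i)) =
      Fbar h n p x0 (fun ℓ => ((Finset.univ : Finset (Fin m)).filter (fun i => g i = ℓ)).card) xb := by
  have heq : Fsoc h m p x0 (fun i => xb (g i)) = Fbar h n p x0
      (fun ℓ => ((Finset.univ : Finset (Fin m)).filter (fun i => g i = ℓ)).card) xb := by
    refine Fsoc_eq_Fbar h m n p x0 g _ xb fun ℓ => ?_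
    rw [Finset.sum_congr rfl (g := fun _ => xb ℓ)
      fun i hi => congrArg xb (Finset.mem_filter.mp hi).2, Finset.sum_const, Nat.cast_smul_eq_nsmul]
  refine ⟨fun i => hxb (g i), fun y hy => ?_, heq⟩
  choose yb hyb hsum using fun ℓ =>
    (convex_Xset h (γb ℓ) (lob ℓ) (hib ℓ)).exists_card_smul_eq_sum (hXne ℓ)
      ((Finset.univ : Finset (Fin m)).filter (fun i => g i = ℓ)) y
      (fun i hi => (Finset.mem_filter.mp hi).2 ▸ hy i)
  rw [heq, Fsoc_eq_Fbar h m n p x0 g y yb hsum]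
  exact hxbmin yb hyb
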